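/- For every odd positive integer a, there exists t ≥ 0 such that the Collatz sequences of a and of 24t + 21 are equivalent. In particular, the Collatz sequence of every odd number is equivalent to the Collatz sequence of an odd number that is divisible by 3 and congruent to 21 mod 24. -/

import Mathlib

/-- One step of the Collatz map. -/
def collatzStep (n : ℕ) : ℕ := if Odd n then 3 * n + 1 else n / 2

/-- For an odd number `a`, the next odd number occurring in the Collatz
sequence of `a`: `(3a+1)/2^v` where `2^v` is the largest power of `2`
dividing `3a+1`. -/
def nextOdd (a : ℕ) : ℕ := (3 * a + 1) / 2 ^ (3 * a + 1).factorization 2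

/-- The sequence of odd numbers in the Collatz sequence of an odd number `A`. -/
def oddSeq (A : ℕ) (i : ℕ) : ℕ := nextOdd^[i] A

/-- Two Collatz sequences merge: they become equal after finitely many terms. -/
def collMerges (A B : ℕ) : Prop := ∃ i j, collatzStep^[i] A = collatzStep^[j] B

/-- Two Collatz sequences (of odd starting numbers) are equivalent:
the second odd number occurring in each sequence is the same. -/
def collEquiv (A B : ℕ) : Prop := nextOdd A = nextOdd B

/-- `A` is a jump from `P` of height `d`:
`A = 4^d * P + 4^(d-1) + ... + 4 + 1`. -/
def isJump (A P d : ℕ) : Prop := 1 ≤ d ∧ A = 4 ^ d * P + (4 ^ d - 1) / 3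

theorem nextOdd_four_mul_add_one (a : ℕ) : nextOdd (4 * a + 1) = nextOdd a := by
  have h : 3 * (4 * a + 1) + 1 = 2 ^ 2 * (3 * a + 1) := by ring
  have hf : (2 ^ 2 * (3 * a + 1)).factorization 2 = 2 + (3 * a + 1).factorization 2 := by
    rw [Nat.factorization_mul (by norm_num) (by lia), Finsupp.add_apply,
      Nat.prime_two.factorization_pow, Finsupp.single_eq_same]
  rw [nextOdd, nextOdd, h, hf, pow_add, Nat.mul_div_mul_left _ _ (by norm_num)]

theorem stmt14 (a : ℕ) (ha : Odd a) (hapos : 0 < a) :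
    ∃ t, collEquiv a (24 * t + 21) ∧ Odd (24 * t + 21) ∧
      3 ∣ (24 * t + 21) ∧ (24 * t + 21) % 24 = 21 := by
  suffices h : ∃ t, collEquiv a (24 * t + 21) by
    obtain ⟨t, ht⟩ := h
    exact ⟨t, ht, ⟨12 * t + 10, by ring⟩, by lia, by lia⟩
  obtain ⟨k, rfl⟩ := ha
  have h1 := nextOdd_four_mul_add_one (2 * k + 1)
  have h2 := (nextOdd_four_mul_add_one (4 * (2 * k + 1) + 1)).trans h1
  have h3 := (nextOdd_four_mul_add_one (4 * (4 * (2 * k + 1) + 1) + 1)).trans h2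
  have hk : k % 3 = 0 ∨ k % 3 = 1 ∨ k % 3 = 2 := by lia
  rcases hk with hk | hk | hk
  · obtain ⟨m, rfl⟩ : ∃ m, k = 3 * m := ⟨k / 3, by lia⟩
    refine ⟨4 * m, ?_⟩
    rw [collEquiv, ← h2]
    congr 1
    ring
  · obtain ⟨m, rfl⟩ : ∃ m, k = 3 * m + 1 := ⟨k / 3, by lia⟩
    refine ⟨16 * m + 8, ?_⟩
    rw [collEquiv, ← h3]
    congr 1
    ring
  · obtain ⟨m, rfl⟩ : ∃ m, k = 3 * m + 2 := ⟨k / 3, by lia⟩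
    refine ⟨m, ?_⟩
    rw [collEquiv, ← h1]
    congr 1
    ring
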